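/- Let w be harmonic on Ω ⊆ ℝ³, let Γ : I → Ω be a real analytic curve in the critical set of w with d(y) = k for all y ∈ Γ, and fix t₀ with tangent vector v₀ = Γ'(t₀) ≠ 0. Let p be the degree-k homogeneous term of the Taylor expansion of w at Γ(t₀). Then p(ξ + s v₀) = p(ξ) for all ξ ∈ ℝ³ and s ∈ ℝ; i.e., p is a homogeneous harmonic polynomial of two variables in coordinates where v₀ is one axis. -/

import Mathlib

/-- `f` is harmonic on `s`: it is `C²` there and its Laplacian vanishes. -/
def IsHarmonicOn (f : (Fin 3 → ℝ) → ℝ) (s : Set (Fin 3 → ℝ)) : Prop :=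
  ContDiffOn ℝ 2 f s ∧
    ∀ x ∈ s, ∑ i : Fin 3, iteratedFDeriv ℝ 2 f x (fun _ => Pi.single i 1) = 0

open MeasureTheory Set Filter Topology
open scoped ContDiff Convolution

/-- A nonnegative radial bump `φ`, together with `Φ` satisfying `∇Φ(y) = φ(y) y`. -/
theorem exists_radial_bump_with_potential (ι : Type*) [Fintype ι] [DecidableEq ι] :
    ∃ φ Φ : (ι → ℝ) → ℝ, ContDiff ℝ ∞ φ ∧ ContDiff ℝ 1 Φ ∧ (∀ y, 2 ≤ ‖y‖ → φ y = 0) ∧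
      (∀ y, 2 ≤ ‖y‖ → Φ y = 0) ∧ (∀ y i, fderiv ℝ Φ y (Pi.single i 1) = φ y * y i) ∧
      0 < ∫ y, φ y := by
  let h : ContDiffBump (0 : ℝ) := ⟨1, 2, one_pos, one_lt_two⟩
  have hcont : Continuous h := h.continuous
  let G : ℝ → ℝ := fun r => 2⁻¹ * ∫ t in (4 : ℝ)..r, h t
  have hG : ∀ r, HasDerivAt G (2⁻¹ * h r) r := fun r =>
    (intervalIntegral.integral_hasDerivAt_right (hcont.intervalIntegrable _ _)
      (hcont.stronglyMeasurableAtFilter _ _) hcont.continuousAt).const_mul _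
  have hGd : deriv G = fun r => 2⁻¹ * h r := funext fun r => (hG r).deriv
  have hG1 : ContDiff ℝ 1 G := by
    rw [contDiff_one_iff_deriv]
    exact ⟨fun r => (hG r).differentiableAt, by rw [hGd]; fun_prop⟩
  let q : (ι → ℝ) → ℝ := fun y => ∑ i, y i ^ 2
  have hq : ContDiff ℝ ∞ q := by fun_prop
  have hh0 : ∀ r, 4 ≤ r → h r = 0 := fun r hr => h.zero_of_le_dist (by
    rw [Real.dist_eq, sub_zero, abs_of_nonneg (by linarith)]
    change (2 : ℝ) ≤ r
    linarith)
  have hq4 : ∀ y : ι → ℝ, 2 ≤ ‖y‖ → 4 ≤ q y := by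
    intro y hy
    have : ‖y‖ ≤ √(q y) := by
      refine (pi_norm_le_iff_of_nonneg (Real.sqrt_nonneg _)).2 fun i => ?_
      rw [Real.norm_eq_abs]
      refine Real.abs_le_sqrt ?_
      exact Finset.single_le_sum (f := fun i => y i ^ 2) (fun j _ => sq_nonneg _)
        (Finset.mem_univ i)
    have h2 := Real.le_sqrt' (x := 2) (y := q y) two_pos |>.1 (hy.trans this)
    linarith
  have hφ : ContDiff ℝ ∞ (fun y => h (q y)) := h.contDiff.comp hq
  have hφ0 : ∀ y : ι → ℝ, 2 ≤ ‖y‖ → h (q y) = 0 := fun y hy => hh0 _ (hq4 y hy)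
  refine ⟨fun y => h (q y), fun y => G (q y), hφ, hG1.comp (hq.of_le (by simp)), hφ0, ?_, ?_, ?_⟩
  · intro y hy
    have : ∫ t in (4 : ℝ)..q y, h t = 0 := by
      rw [intervalIntegral.integral_congr (g := fun _ => (0 : ℝ))]
      · simp
      · intro t ht
        rw [uIcc_of_le (hq4 y hy)] at ht
        exact hh0 t ht.1
    simp [G, this]
  · intro y i
    have hqd : HasFDerivAt q (∑ j, (2 * y j) •
        ContinuousLinearMap.proj (R := ℝ) (φ := fun _ : ι => ℝ) j) y := by
      refine HasFDerivAt.fun_sum fun j _ => ?_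
      simpa using ((ContinuousLinearMap.proj (R := ℝ) (φ := fun _ : ι => ℝ) j).hasFDerivAt
        (x := y)).pow 2
    rw [show fderiv ℝ (fun y => G (q y)) y = _ from ((hG (q y)).comp_hasFDerivAt y hqd).fderiv]
    simp [Pi.single_apply]
    ring
  · refine hφ.continuous.integral_pos_of_hasCompactSupport_nonneg_nonzero (x := 0) ?_
      (fun y => h.nonneg) ?_
    · exact HasCompactSupport.intro (isCompact_closedBall (0 : ι → ℝ) 2) fun y hy => hφ0 y (by
        simp at hy; exact hy.le)
    · have : h (q 0) = 1 := h.one_of_mem_closedBall (by simp [q, h])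
      simp [this]

/-- Differentiation under the integral sign for an average of dilates of `f`. -/
theorem hasDerivAt_integral_mul_comp_sub_smul {E : Type*} [NormedAddCommGroup E] [NormedSpace ℝ E]
    [MeasurableSpace E] [BorelSpace E] [FiniteDimensional ℝ E]
    {μ : Measure E} [IsFiniteMeasureOnCompacts μ] {φ f : E → ℝ} (hφ : Continuous φ)
    (hφc : HasCompactSupport φ) (hf : ContDiff ℝ 1 f) (hfc : HasCompactSupport f) (x : E) (ε : ℝ) :
    HasDerivAt (fun ε : ℝ => ∫ y, φ y * f (x - ε • y) ∂μ)
      (∫ y, φ y * fderiv ℝ f (x - ε • y) (-y) ∂μ) ε := by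
  have hf' : Continuous (fderiv ℝ f) := hf.continuous_fderiv one_ne_zero
  obtain ⟨C, hC⟩ := (hfc.fderiv ℝ).exists_bound_of_continuous hf'
  have hfcont := hf.continuous
  refine (hasDerivAt_integral_of_dominated_loc_of_deriv_le
    (F' := fun ε y => φ y * fderiv ℝ f (x - ε • y) (-y))
    (bound := fun y => ‖φ y‖ * (C * ‖y‖)) univ_mem ?_ ?_ ?_ ?_ ?_ ?_).2
  · exact Eventually.of_forall fun e => Continuous.aestronglyMeasurable (by fun_prop)
  · exact Continuous.integrable_of_hasCompactSupport (by fun_prop) hφc.mul_right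
  · exact Continuous.aestronglyMeasurable (by fun_prop)
  · refine Eventually.of_forall fun y e _ => ?_
    rw [norm_mul]
    gcongr
    refine (ContinuousLinearMap.le_opNorm _ _).trans ?_
    rw [norm_neg]
    gcongr
    exact hC _
  · exact Continuous.integrable_of_hasCompactSupport (by fun_prop) hφc.norm.mul_right
  · refine Eventually.of_forall fun y e _ => ?_
    have h1 : HasDerivAt (fun e : ℝ => x - e • y) (-y) e := by
      simpa using ((hasDerivAt_id e).smul_const y).const_sub x
    exact ((hf.differentiable one_ne_zero _).hasFDerivAt.comp_hasDerivAt e h1).const_mul _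

/-- Weighted mean value property: averaging against a radial bump reproduces the value at the
centre of a ball on which the Laplacian vanishes. -/
theorem integral_mul_comp_sub_smul_eq {ι : Type*} [Fintype ι] [DecidableEq ι]
    {φ Φ f : (ι → ℝ) → ℝ} (hφ : Continuous φ) (hΦ : ContDiff ℝ 1 Φ)
    (hφ0 : ∀ y, 2 ≤ ‖y‖ → φ y = 0) (hΦ0 : ∀ y, 2 ≤ ‖y‖ → Φ y = 0)
    (hΦφ : ∀ y i, fderiv ℝ Φ y (Pi.single i 1) = φ y * y i)
    (hf : ContDiff ℝ 2 f) (hfc : HasCompactSupport f) {x : ι → ℝ} {δ : ℝ} (hδ : 0 < δ)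
    (hlap : ∀ z ∈ Metric.ball x (2 * δ),
      ∑ i, fderiv ℝ (fderiv ℝ f) z (Pi.single i 1) (Pi.single i 1) = 0) :
    ∫ y, φ y * f (x - δ • y) = (∫ y, φ y) * f x := by
  have hcs : ∀ u : (ι → ℝ) → ℝ, (∀ y, 2 ≤ ‖y‖ → u y = 0) → HasCompactSupport u := fun u hu =>
    HasCompactSupport.intro (isCompact_closedBall (0 : ι → ℝ) 2) fun y hy => hu y (by
      simp at hy; exact hy.le)
  have hφc := hcs φ hφ0
  have hΦc := hcs Φ hΦ0
  have hf1 : ContDiff ℝ 1 (fderiv ℝ f) := hf.fderiv_right (by norm_num)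
  have hf1c := hf1.continuous
  have hf2c : Continuous (fderiv ℝ (fderiv ℝ f)) := hf1.continuous_fderiv one_ne_zero
  have hΦcont := hΦ.continuous
  have hderiv := fun ε =>
    hasDerivAt_integral_mul_comp_sub_smul (μ := volume) hφ hφc (hf.of_le one_le_two) hfc x ε
  have hzero : ∀ ε ∈ Ico (0 : ℝ) δ, ∫ y, φ y * fderiv ℝ f (x - ε • y) (-y) = 0 := by
    intro ε hε
    have hg : ∀ i y, HasFDerivAt (fun y => fderiv ℝ f (x - ε • y) (Pi.single i 1))
        ((-ε) • (fderiv ℝ (fderiv ℝ f) (x - ε • y)).flip (Pi.single i 1)) y := by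
      intro i y
      have h1 : HasFDerivAt (fun y : ι → ℝ => x - ε • y)
          (-(ε • ContinuousLinearMap.id ℝ (ι → ℝ))) y :=
        ((hasFDerivAt_id y).const_smul ε).const_sub x
      have h2 := ((hf1.differentiable one_ne_zero _).hasFDerivAt.comp y h1).clm_apply
        (hasFDerivAt_const (Pi.single i 1 : ι → ℝ) y)
      refine h2.congr_fderiv ?_
      ext v
      simp
    have hgd : ∀ i y, fderiv ℝ (fun y => fderiv ℝ f (x - ε • y) (Pi.single i 1)) y
        (Pi.single i 1) =
        -ε * fderiv ℝ (fderiv ℝ f) (x - ε • y) (Pi.single i 1) (Pi.single i 1) := by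
      intro i y
      rw [(hg i y).fderiv]
      simp
    have hparts : ∀ i, ∫ y, φ y * y i * fderiv ℝ f (x - ε • y) (Pi.single i 1) =
        ε * ∫ y, Φ y * fderiv ℝ (fderiv ℝ f) (x - ε • y) (Pi.single i 1) (Pi.single i 1) := by
      intro i
      have := integral_mul_fderiv_eq_neg_fderiv_mul_of_integrable (μ := volume) (𝕜 := ℝ)
        (f := Φ) (g := fun y => fderiv ℝ f (x - ε • y) (Pi.single i 1)) (v := Pi.single i 1)
        ?_ ?_ ?_ (fun y _ => hΦ.differentiable one_ne_zero y)
        (fun y _ => (hg i y).differentiableAt)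
      · simp only [hgd, hΦφ] at this
        rw [← neg_eq_iff_eq_neg] at this
        rw [← this, ← integral_neg, ← integral_const_mul]
        congr 1 with y
        ring
      · simp only [hΦφ]
        exact Continuous.integrable_of_hasCompactSupport (by fun_prop) hφc.mul_right.mul_right
      · simp only [hgd]
        exact Continuous.integrable_of_hasCompactSupport (by fun_prop) hΦc.mul_right
      · exact Continuous.integrable_of_hasCompactSupport (by fun_prop) hΦc.mul_right
    calc ∫ y, φ y * fderiv ℝ f (x - ε • y) (-y)
        = ∫ y, -∑ i, φ y * y i * fderiv ℝ f (x - ε • y) (Pi.single i 1) := by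
          congr 1 with y
          have hy := congrArg (fderiv ℝ f (x - ε • y)) (pi_eq_sum_univ' y)
          rw [map_neg, hy]
          simp only [map_sum, map_smul, smul_eq_mul, mul_neg, Finset.mul_sum, mul_assoc]
      _ = -∑ i, ε * ∫ y, Φ y *
            fderiv ℝ (fderiv ℝ f) (x - ε • y) (Pi.single i 1) (Pi.single i 1) := by
          rw [integral_neg, integral_finsetSum]
          · simp only [hparts]
          · exact fun i _ => Continuous.integrable_of_hasCompactSupport (by fun_prop)
              hφc.mul_right.mul_right
      _ = -(ε * ∫ y, Φ y *
            ∑ i, fderiv ℝ (fderiv ℝ f) (x - ε • y) (Pi.single i 1) (Pi.single i 1)) := by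
          simp only [Finset.mul_sum]
          rw [integral_finsetSum, Finset.mul_sum]
          exact fun i _ => Continuous.integrable_of_hasCompactSupport (by fun_prop) hΦc.mul_right
      _ = 0 := by
          rw [integral_eq_zero_of_ae, mul_zero, neg_zero]
          refine Eventually.of_forall fun y => ?_
          rcases le_or_gt 2 ‖y‖ with hy | hy
          · simp [hΦ0 y hy]
          · have : x - ε • y ∈ Metric.ball x (2 * δ) := by
              rw [Metric.mem_ball, dist_eq_norm, sub_sub_cancel_left, norm_neg, norm_smul,
                Real.norm_of_nonneg hε.1]
              nlinarith [hε.1, hε.2, norm_nonneg y]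
            simp [hlap _ this]
  have hconst := constant_of_has_deriv_right_zero (a := 0) (b := δ)
    (fun ε _ => (hderiv ε).continuousAt.continuousWithinAt)
    (fun ε hε => by simpa only [hzero ε hε] using (hderiv ε).hasDerivWithinAt) δ ⟨hδ.le, le_rfl⟩
  rw [hconst, ← integral_mul_const]
  simp

/-- A `C²` function whose Laplacian vanishes on an open set is smooth there. -/
theorem contDiffAt_of_laplacian_eq_zero {ι : Type*} [Fintype ι] [DecidableEq ι]
    {f : (ι → ℝ) → ℝ} {s : Set (ι → ℝ)} (hs : IsOpen s) (hf : ContDiffOn ℝ 2 f s)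
    (hlap : ∀ z ∈ s, ∑ i, fderiv ℝ (fderiv ℝ f) z (Pi.single i 1) (Pi.single i 1) = 0)
    {x : ι → ℝ} (hx : x ∈ s) : ContDiffAt ℝ ∞ f x := by
  obtain ⟨r, hr, hrs⟩ := Metric.isOpen_iff.1 hs x hx
  let χ : ContDiffBump x := ⟨r / 3, r / 2, by positivity, by linarith⟩
  let g : (ι → ℝ) → ℝ := fun y => χ y * f y
  have hg : ContDiff ℝ 2 g := by
    rw [contDiff_iff_contDiffAt]
    intro y
    by_cases hy : y ∈ s
    · exact χ.contDiffAt.mul (hf.contDiffAt (hs.mem_nhds hy))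
    · have : y ∉ tsupport χ := fun h => hy (hrs (by
        rw [χ.tsupport_eq] at h
        exact Metric.closedBall_subset_ball (half_lt_self hr) h))
      rw [notMem_tsupport_iff_eventuallyEq] at this
      refine (contDiffAt_const (c := (0 : ℝ))).congr_of_eventuallyEq ?_
      filter_upwards [this] with z hz
      simp [g, hz]
  have hgc : HasCompactSupport g := χ.hasCompactSupport.mul_right
  have hgf : ∀ y ∈ Metric.ball x (r / 3), g =ᶠ[𝓝 y] f := by
    intro y hy
    filter_upwards [Metric.isOpen_ball.mem_nhds hy] with z hz
    simp [g, χ.one_of_mem_closedBall (Metric.ball_subset_closedBall hz)]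
  have hglap : ∀ z ∈ Metric.ball x (r / 3),
      ∑ i, fderiv ℝ (fderiv ℝ g) z (Pi.single i 1) (Pi.single i 1) = 0 := by
    intro z hz
    rw [(hgf z hz).fderiv.fderiv_eq]
    exact hlap z (hrs (Metric.ball_subset_ball (by linarith) hz))
  obtain ⟨φ, Φ, hφ, hΦ, hφ0, hΦ0, hΦφ, hpos⟩ := exists_radial_bump_with_potential ι
  let δ := r / 12
  have hδ : 0 < δ := by positivity
  let ψ : (ι → ℝ) → ℝ := fun z => φ (δ⁻¹ • z)
  have hψ : ContDiff ℝ ∞ ψ := hφ.comp (contDiff_const_smul _)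
  have hψc : HasCompactSupport ψ := by
    refine HasCompactSupport.intro (isCompact_closedBall (0 : ι → ℝ) (2 * δ)) fun y hy => ?_
    refine hφ0 _ ?_
    rw [mem_closedBall_zero_iff, not_le] at hy
    rw [norm_smul, norm_inv, Real.norm_of_nonneg hδ.le, le_inv_mul_iff₀ hδ]
    linarith
  have hconv : ContDiff ℝ ∞ (ψ ⋆[ContinuousLinearMap.mul ℝ ℝ, volume] g) :=
    hψc.contDiff_convolution_left _ hψ hg.continuous.locallyIntegrable
  have hmean : ∀ y ∈ Metric.ball x (r / 6), g y = (∫ z, φ z)⁻¹ *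
      (|(δ ^ Module.finrank ℝ (ι → ℝ))⁻¹| * (ψ ⋆[ContinuousLinearMap.mul ℝ ℝ, volume] g) y) := by
    intro y hy
    rw [eq_inv_mul_iff_mul_eq₀ hpos.ne',
      ← integral_mul_comp_sub_smul_eq hφ.continuous hΦ hφ0 hΦ0 hΦφ hg hgc hδ fun z hz => hglap z ?_]
    · have := Measure.integral_comp_smul volume (fun z => ψ z * g (y - z)) δ
      simpa [ψ, smul_smul, hδ.ne', convolution_def] using this
    · rw [Metric.mem_ball] at hz hy ⊢
      have := dist_triangle z y x
      simp only [δ] at hz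
      linarith
  have hgx : ContDiffAt ℝ ∞ g x := by
    refine ContDiffAt.congr_of_eventuallyEq
      (contDiff_const.mul (contDiff_const.mul hconv)).contDiffAt
      (eventually_of_mem (Metric.ball_mem_nhds x (show 0 < r / 6 by positivity)) hmean)
  exact hgx.congr_of_eventuallyEq (hgf x (Metric.mem_ball_self (by positivity))).symm

/-- A multilinear map vanishing as soon as one argument equals `u` is invariant, on the diagonal,
under translation by `u`. -/
theorem ContinuousMultilinearMap.map_const_add_of_forall_eq_zero {𝕜 E F : Type*} [Ring 𝕜]
    [AddCommGroup E] [Module 𝕜 E] [TopologicalSpace E] [AddCommGroup F] [Module 𝕜 F]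
    [TopologicalSpace F] {ι : Type*} [Fintype ι]
    (M : ContinuousMultilinearMap 𝕜 (fun _ : ι => E) F) {u : E}
    (hM : ∀ m : ι → E, ∀ i, m i = u → M m = 0) (ξ : E) :
    M (fun _ => ξ + u) = M (fun _ => ξ) := by
  classical
  have := M.map_add_univ (fun _ => ξ) (fun _ => u)
  rw [show ((fun _ => ξ) + fun _ => u : ι → E) = fun _ => ξ + u from rfl] at this
  rw [this, Finset.sum_eq_single Finset.univ]
  · simp
  · intro s _ hs
    obtain ⟨i, hi⟩ : ∃ i, i ∉ s := by
      by_contra! h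
      exact hs (Finset.eq_univ_iff_forall.2 h)
    exact hM _ i (by simp [hi])
  · simp


/-- Iterated derivatives commute with the directional derivative along a fixed vector. -/
theorem ContDiffAt.iteratedFDeriv_fderiv_apply_const {E F : Type*} [NormedAddCommGroup E]
    [NormedSpace ℝ E] [NormedAddCommGroup F] [NormedSpace ℝ F] {f : E → F} {n : ℕ} {x : E}
    (hf : ContDiffAt ℝ (n + 1 : ℕ) f x) (v : E) :
    iteratedFDeriv ℝ n (fun y => fderiv ℝ f y v) x = fderiv ℝ (iteratedFDeriv ℝ n f) x v := by
  induction n generalizing x with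
  | zero =>
    ext m
    have h := iteratedFDeriv_succ_apply_left (𝕜 := ℝ) (f := f) (x := x) (n := 0) (Fin.cons v m)
    rw [Fin.cons_zero, Fin.tail_cons] at h
    rw [← h, iteratedFDeriv_zero_apply, iteratedFDeriv_one_apply, Fin.cons_zero]
  | succ n ih =>
    have hD : ContDiffAt ℝ 2 (iteratedFDeriv ℝ n f) x :=
      hf.iteratedFDeriv_right (by norm_cast; omega)
    have hev : iteratedFDeriv ℝ n (fun y => fderiv ℝ f y v) =ᶠ[𝓝 x]
        fun y => fderiv ℝ (iteratedFDeriv ℝ n f) y v :=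
      (hf.eventually (by simp)).mono fun y hy => ih (hy.of_le (by norm_cast; omega))
    have hD1 : DifferentiableAt ℝ (fderiv ℝ (iteratedFDeriv ℝ n f)) x :=
      (hD.fderiv_right (m := 1) (by norm_num)).differentiableAt one_ne_zero
    have hDs : DifferentiableAt ℝ (iteratedFDeriv ℝ (n + 1) f) x :=
      (hf.iteratedFDeriv_right (m := 1) (by norm_cast; omega)).differentiableAt one_ne_zero
    ext m
    have hR : fderiv ℝ (iteratedFDeriv ℝ (n + 1) f) x v m =
        fderiv ℝ (fderiv ℝ (iteratedFDeriv ℝ n f)) x v (m 0) (Fin.tail m) := by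
      rw [← fderiv_continuousMultilinear_apply_const_apply hDs]
      simp only [iteratedFDeriv_succ_apply_left]
      rw [fderiv_continuousMultilinear_apply_const_apply
        (hD1.clm_apply (differentiableAt_const (m 0))),
        fderiv_clm_apply hD1 (differentiableAt_const (m 0))]
      simp
    rw [hR, iteratedFDeriv_succ_apply_left, hev.fderiv_eq,
      fderiv_clm_apply hD1 (differentiableAt_const v), (hD.isSymmSndFDerivAt (by simp)).eq v (m 0)]
    simp

/-- Iterated derivatives are invariant under cyclic rotation of their arguments. -/
theorem ContDiffAt.iteratedFDeriv_comp_finRotate {E F : Type*} [NormedAddCommGroup E]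
    [NormedSpace ℝ E] [NormedAddCommGroup F] [NormedSpace ℝ F] {f : E → F} {n : ℕ} {x : E}
    (hf : ContDiffAt ℝ (n + 1 : ℕ) f x) (m : Fin (n + 1) → E) :
    iteratedFDeriv ℝ (n + 1) f x (m ∘ finRotate (n + 1)) = iteratedFDeriv ℝ (n + 1) f x m := by
  have hm : m ∘ finRotate (n + 1) = Fin.snoc (α := fun _ => E) (Fin.tail m) (m 0) := by
    rw [Fin.snoc_eq_cons_rotate]
    ext i
    simp only [Fin.cons_self_tail, Function.comp_apply]
  have hd : ContDiffAt ℝ n (fderiv ℝ f) x := hf.fderiv_right (by norm_cast)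
  rw [hm, iteratedFDeriv_succ_apply_right, Fin.init_snoc, Fin.snoc_last,
    iteratedFDeriv_succ_apply_left, ← hf.iteratedFDeriv_fderiv_apply_const]
  exact ((ContinuousLinearMap.apply ℝ F (m 0)).iteratedFDeriv_comp_left hd le_rfl ▸ rfl)

/-- If the `n`-th derivative vanishes along a curve, the `(n + 1)`-st one vanishes as soon as one
argument is the velocity of the curve. -/
theorem ContDiffAt.iteratedFDeriv_succ_eq_zero_of_vanish_along {E F : Type*}
    [NormedAddCommGroup E] [NormedSpace ℝ E] [NormedAddCommGroup F] [NormedSpace ℝ F]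
    {f : E → F} {n : ℕ} {γ : ℝ → E} {γ' : E} {t : ℝ}
    (hf : ContDiffAt ℝ (n + 1 : ℕ) f (γ t)) (hγ : HasDerivAt γ γ' t)
    (h0 : ∀ᶠ s in 𝓝 t, iteratedFDeriv ℝ n f (γ s) = 0) (m : Fin (n + 1) → E) (i : Fin (n + 1))
    (hm : m i = γ') : iteratedFDeriv ℝ (n + 1) f (γ t) m = 0 := by
  induction i using Fin.induction generalizing m with
  | zero =>
    have hD : DifferentiableAt ℝ (iteratedFDeriv ℝ n f) (γ t) :=
      (hf.iteratedFDeriv_right (m := 1) (by norm_cast; omega)).differentiableAt one_ne_zero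
    have h1 := hD.hasFDerivAt.comp_hasDerivAt t hγ
    have h2 : HasDerivAt (iteratedFDeriv ℝ n f ∘ γ) 0 t :=
      (hasDerivAt_const t 0).congr_of_eventuallyEq h0
    rw [iteratedFDeriv_succ_apply_left, hm, h1.unique h2]
    rfl
  | succ i ih =>
    rw [← hf.iteratedFDeriv_comp_finRotate]
    exact ih _ (by rw [Function.comp_apply, finRotate_apply, Fin.coeSucc_eq_succ, hm])

/-- Along an analytic curve `γ` in the critical set of a harmonic function `w` on
`Ω ⊆ ℝ³` where the vanishing order is constantly `k`, the degree-`k` homogeneous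
Taylor term `p` of `w` at `γ t₀` is invariant under translation in the tangent
direction `v₀ = γ'(t₀)`: `p(ξ + s·v₀) = p(ξ)`, i.e. `p` is a homogeneous harmonic
polynomial of two variables in suitable coordinates. -/
theorem stmt16 (Ω : Set (Fin 3 → ℝ)) (hΩ : IsOpen Ω)
    (w : (Fin 3 → ℝ) → ℝ) (hw : IsHarmonicOn w Ω)
    (I : Set ℝ) (hI : IsOpen I) (hIconn : IsConnected I)
    (γ : ℝ → (Fin 3 → ℝ)) (hγ : AnalyticOn ℝ γ I) (hγΩ : ∀ t ∈ I, γ t ∈ Ω)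
    (k : ℕ)
    (hd : ∀ t ∈ I, (∀ m : ℕ, m < k → iteratedFDeriv ℝ m w (γ t) = 0) ∧
      iteratedFDeriv ℝ k w (γ t) ≠ 0)
    (t₀ : ℝ) (ht₀ : t₀ ∈ I) (v₀ : Fin 3 → ℝ) (hv₀ : v₀ = deriv γ t₀) (hv₀ne : v₀ ≠ 0) :
    ∀ ξ : Fin 3 → ℝ, ∀ s : ℝ,
      ((k.factorial : ℝ)⁻¹ * iteratedFDeriv ℝ k w (γ t₀) (fun _ => ξ + s • v₀)) =
        (k.factorial : ℝ)⁻¹ * iteratedFDeriv ℝ k w (γ t₀) (fun _ => ξ) := by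
  intro ξ s
  cases k with
  | zero => congr 2; exact Subsingleton.elim _ _
  | succ n =>
    have hsm : ContDiffAt ℝ (n + 1 : ℕ) w (γ t₀) :=
      (contDiffAt_of_laplacian_eq_zero hΩ hw.1
        (fun z hz => by simpa only [iteratedFDeriv_two_apply] using hw.2 z hz)
        (hγΩ t₀ ht₀)).of_le (by exact_mod_cast le_top)
    have hγ' : HasDerivAt γ v₀ t₀ := hv₀ ▸
      (hγ.differentiableOn.differentiableAt (hI.mem_nhds ht₀)).hasDerivAt
    have h0 : ∀ᶠ t in 𝓝 t₀, iteratedFDeriv ℝ n w (γ t) = 0 :=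
      eventually_of_mem (hI.mem_nhds ht₀) fun t ht => (hd t ht).1 n n.lt_succ_self
    congr 1
    refine ContinuousMultilinearMap.map_const_add_of_forall_eq_zero _ (fun m i hm => ?_) ξ
    have hup := (iteratedFDeriv ℝ (n + 1) w (γ t₀)).map_update_smul m i s v₀
    rw [← hm, Function.update_eq_self] at hup
    rw [hup, hsm.iteratedFDeriv_succ_eq_zero_of_vanish_along hγ' h0 _ i (Function.update_self ..),
      smul_zero]
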